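/- If a finite group G acts freely on an even-dimensional sphere S^n (n even, n ≥ 2) by homeomorphisms, then G is trivial or cyclic of order 2. -/

import Mathlib

open Metric

/-- The `N`-sphere, as the unit sphere in `ℝ^{N+1}`. -/
abbrev Sph (N : ℕ) : Type := Metric.sphere (0 : EuclideanSpace ℝ (Fin (N + 1))) 1

open MeasureTheory

/-- Lagrange interpolation: the determinant is a fixed combination of `det (1 + v i A)`. -/
theorem aux_det_interp {E : Type*} [AddCommGroup E] [Module ℝ E] [FiniteDimensional ℝ E]
    (ε : ℝ) (hε : 0 < ε) :
    ∃ (s : Finset ℕ) (v w : ℕ → ℝ), (∀ i ∈ s, |v i| ≤ ε) ∧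
      ∀ A : E →ₗ[ℝ] E, LinearMap.det A = ∑ i ∈ s, w i * LinearMap.det (1 + v i • A) := by
  classical
  set m := Module.finrank ℝ E with hm
  set s := Finset.range (m + 1) with hs
  set v : ℕ → ℝ := fun i => ε / (i + 1) with hv
  have hinj : Set.InjOn v s := by
    intro i _ j _ h
    have h1 : ((i : ℝ) + 1) ≠ 0 := by positivity
    have h2 : ((j : ℝ) + 1) ≠ 0 := by positivity
    simp only [hv] at h
    field_simp at h
    exact_mod_cast (by linarith : (i : ℝ) = j)
  refine ⟨s, v, fun i => (∏ j ∈ s.erase i, (v i - v j))⁻¹, ?_, ?_⟩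
  · intro i _
    have h1 : (1 : ℝ) ≤ (i : ℝ) + 1 := by linarith [(Nat.cast_nonneg i : (0 : ℝ) ≤ i)]
    simp only [hv]
    rw [abs_of_nonneg (by positivity)]
    exact div_le_self hε.le h1
  · intro A
    let b := Module.finBasis ℝ E
    let M := LinearMap.toMatrix b b A
    let P : Polynomial ℝ := Matrix.det
      ((Polynomial.X : Polynomial ℝ) • M.map Polynomial.C + (1 : Matrix _ _ ℝ).map Polynomial.C)
    have hdeg : P.degree < s.card := by
      have := Polynomial.natDegree_det_X_add_C_le M 1
      refine lt_of_le_of_lt Polynomial.degree_le_natDegree ?_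
      simp only [hs, Finset.card_range, Fintype.card_fin] at this ⊢
      exact_mod_cast Nat.lt_succ_of_le this
    have h1 := Lagrange.coeff_eq_sum hinj hdeg
    have h2 : P.coeff (s.card - 1) = LinearMap.det A := by
      have := Polynomial.coeff_det_X_add_C_card M 1
      simp only [Fintype.card_fin] at this
      simp only [hs, Finset.card_range, Nat.add_sub_cancel]
      rw [show P.coeff m = M.det from this, LinearMap.det_toMatrix]
    have h3 : ∀ t : ℝ, P.eval t = LinearMap.det (1 + t • A) := by
      intro t
      rw [← LinearMap.det_toMatrix b, map_add, map_smul, LinearMap.toMatrix_one]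
      simp only [P]
      rw [← Polynomial.coe_evalRingHom, RingHom.map_det]
      congr 1
      ext i j
      by_cases hij : i = j
      · subst hij; simp [M, add_comm]; ring
      · simp [M, hij]; ring
    rw [← h2, h1]
    refine Finset.sum_congr rfl fun i _ => ?_
    rw [h3, div_eq_inv_mul]

/-- A compactly supported `C¹` map has zero total Jacobian. -/
theorem aux_integral_det {E : Type*} [NormedAddCommGroup E] [InnerProductSpace ℝ E]
    [FiniteDimensional ℝ E] [Nontrivial E] [MeasurableSpace E] [BorelSpace E]
    (F : E → E) (hF : ContDiff ℝ 1 F) (hc : HasCompactSupport F) :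
    ∫ x, (fderiv ℝ F x).det = 0 := by
  classical
  have hdetc : Continuous (fun A : E →L[ℝ] E => A.det) := ContinuousLinearMap.continuous_det
  have hDc : Continuous (fderiv ℝ F) := hF.continuous_fderiv (by norm_num)
  have hdiff : Differentiable ℝ F := hF.differentiable (by norm_num)
  obtain ⟨R, hR0, hR⟩ : ∃ R : ℝ, 0 < R ∧ tsupport F ⊆ Metric.closedBall 0 R := by
    obtain ⟨R, hR⟩ := hc.isCompact.isBounded.subset_closedBall (0 : E)
    exact ⟨max R 1, by positivity, hR.trans (Metric.closedBall_subset_closedBall (le_max_left _ _))⟩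
  obtain ⟨C, hC⟩ : ∃ C, ∀ x, ‖fderiv ℝ F x‖ ≤ C :=
    (hc.fderiv (𝕜 := ℝ)).exists_bound_of_continuous hDc
  set B := Metric.closedBall (0 : E) R with hB
  have hFout : ∀ x, x ∉ B → F x = 0 := fun x hx => image_eq_zero_of_notMem_tsupport
    (fun h => hx (hR h))
  have hC0 : 0 ≤ C := (norm_nonneg _).trans (hC 0)
  have hlip : LipschitzWith C.toNNReal F :=
    lipschitzWith_of_nnnorm_fderiv_le hdiff (fun x => by
      rw [← NNReal.coe_le_coe, Real.coe_toNNReal _ hC0]; exact hC x)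
  -- positivity of det near identity
  obtain ⟨δ, hδ0, hδ⟩ : ∃ δ > 0, ∀ A : E →L[ℝ] E, ‖A‖ < δ → 0 < (1 + A).det := by
    have h1 : ContinuousAt (fun A : E →L[ℝ] E => (1 + A).det) 0 :=
      (hdetc.comp (continuous_const.add continuous_id)).continuousAt
    have h2 : ∀ᶠ A in nhds (0 : E →L[ℝ] E), 0 < (1 + A).det := by
      apply h1.eventually_const_lt
      simp [ContinuousLinearMap.det]
    obtain ⟨δ, h, h'⟩ := Metric.eventually_nhds_iff.1 h2
    exact ⟨δ, h, fun A hA => h' (by simpa using hA)⟩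
  set ε := min (δ / (2 * (C + 1))) (1 / (2 * (C + 1))) with hεdef
  have hε : 0 < ε := by positivity
  have key : ∀ t : ℝ, |t| ≤ ε → ∫ x in B, (1 + t • fderiv ℝ F x).det = volume.real B := by
    intro t ht
    have ht1 : |t| * C < δ := by
      have : |t| ≤ δ / (2 * (C + 1)) := ht.trans (min_le_left _ _)
      rw [le_div_iff₀ (by positivity)] at this
      nlinarith [abs_nonneg t]
    have ht2 : |t| * C ≤ 1 / 2 := by
      have : |t| ≤ 1 / (2 * (C + 1)) := ht.trans (min_le_right _ _)
      rw [le_div_iff₀ (by positivity)] at this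
      nlinarith [abs_nonneg t]
    set Φ : E → E := fun x => x + t • F x with hΦ
    have hder : ∀ x, HasFDerivAt Φ (1 + t • fderiv ℝ F x) x := fun x =>
      (hasFDerivAt_id x).add ((hdiff x).hasFDerivAt.const_smul t)
    have happ : ApproximatesLinearOn Φ ((ContinuousLinearEquiv.refl ℝ E : E ≃L[ℝ] E) : E →L[ℝ] E)
        Set.univ (1 / 2) := by
      intro x _ y _
      have : Φ x - Φ y - (x - y) = t • (F x - F y) := by
        simp only [hΦ, smul_sub]; abel
      simp only [ContinuousLinearEquiv.coe_refl, ContinuousLinearMap.coe_id', id_eq, this, norm_smul]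
      have h := hlip.norm_sub_le x y
      rw [Real.coe_toNNReal _ hC0] at h
      rw [Real.norm_eq_abs]
      calc |t| * ‖F x - F y‖ ≤ |t| * (C * ‖x - y‖) := by gcongr
        _ = (|t| * C) * ‖x - y‖ := by ring
        _ ≤ (1 / 2) * ‖x - y‖ := by gcongr
        _ = _ := by norm_num
    have hcN : Subsingleton E ∨ (1 / 2 : NNReal) <
        ‖((ContinuousLinearEquiv.refl ℝ E).symm : E →L[ℝ] E)‖₊⁻¹ := by
      right
      have : ‖((ContinuousLinearEquiv.refl ℝ E).symm : E →L[ℝ] E)‖₊ = 1 := by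
        ext; simp
      rw [this, inv_one]
      rw [← NNReal.coe_lt_coe]; norm_num
    have hsurj : Function.Surjective Φ := happ.surjective hcN
    have hinj : Function.Injective Φ := Set.injOn_univ.1 (happ.injOn hcN)
    have hout : ∀ x, x ∉ B → Φ x = x := fun x hx => by simp [hΦ, hFout x hx]
    have himg : Φ '' B = B := by
      apply Set.Subset.antisymm
      · rintro _ ⟨x, hx, rfl⟩
        by_contra h
        have := hinj (hout _ h)
        rw [this] at h
        exact h hx
      · intro y hy
        obtain ⟨x, rfl⟩ := hsurj y
        refine ⟨x, ?_, rfl⟩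
        by_contra h
        rw [hout x h] at hy
        exact h hy
    have hch := integral_image_eq_integral_abs_det_fderiv_smul (volume : Measure E)
      (measurableSet_closedBall : MeasurableSet B) (fun x _ => (hder x).hasFDerivWithinAt)
      hinj.injOn (fun _ => (1 : ℝ))
    rw [himg] at hch
    have e1 : ∀ x, |(1 + t • fderiv ℝ F x).det| • (1 : ℝ) = (1 + t • fderiv ℝ F x).det := by
      intro x
      rw [smul_eq_mul, mul_one, abs_of_pos]
      apply hδ
      rw [norm_smul, Real.norm_eq_abs]
      exact lt_of_le_of_lt (by gcongr; exact hC x) ht1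
    simp only [e1] at hch
    rw [← hch]; simp [Measure.real]
  obtain ⟨s, v, w, hv, hw⟩ := aux_det_interp (E := E) ε hε
  have hw0 : ∑ i ∈ s, w i = 0 := by
    have := hw 0
    simp only [smul_zero, add_zero, map_one, mul_one] at this
    rw [← this]; exact LinearMap.det_zero'' 
  have e2 : ∀ A : E →L[ℝ] E, A.det = ∑ i ∈ s, w i * (1 + v i • A).det := by
    intro A
    exact hw A
  have hsup : ∫ x, (fderiv ℝ F x).det = ∫ x in B, (fderiv ℝ F x).det := by
    symm
    apply setIntegral_eq_integral_of_forall_compl_eq_zero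
    intro x hx
    have : fderiv ℝ F x = 0 := by
      by_contra h
      exact hx (hR (support_fderiv_subset ℝ h))
    rw [this]
    exact LinearMap.det_zero''
  rw [hsup]
  simp_rw [e2 (fderiv ℝ F _)]
  rw [integral_finsetSum]
  · simp_rw [integral_const_mul]
    rw [Finset.sum_congr rfl (fun i hi => by rw [key (v i) (hv i hi)]), ← Finset.sum_mul, hw0,
      zero_mul]
  · intro i _
    have h1 : Continuous (fun x => 1 + v i • fderiv ℝ F x) :=
      continuous_const.add (hDc.const_smul (v i))
    have h2 : Continuous (fun x => w i * (1 + v i • fderiv ℝ F x).det) :=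
      continuous_const.mul (hdetc.comp h1)
    exact h2.continuousOn.integrableOn_compact (isCompact_closedBall _ _)

theorem aux_det_rank_one {E : Type*} [AddCommGroup E] [Module ℝ E] [FiniteDimensional ℝ E]
    (h2 : 2 ≤ Module.finrank ℝ E) (c : ℝ) (f : E →ₗ[ℝ] ℝ) (x : E) :
    LinearMap.det (c • (1 : E →ₗ[ℝ] E) + f.smulRight x) =
      c ^ (Module.finrank ℝ E - 1) * (c + f x) := by
  by_cases hc : c = 0
  · subst hc
    rw [zero_pow (by omega), zero_mul]
    have hk : LinearMap.ker f ≠ ⊥ := LinearMap.ker_ne_bot_of_finrank_lt (by simp; omega)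
    obtain ⟨v, hv, hv0⟩ := (Submodule.ne_bot_iff _).1 hk
    by_contra hdet
    have hu := (LinearMap.isUnit_iff_isUnit_det _).2 (isUnit_iff_ne_zero.2 hdet)
    have hinj := ((Module.End.isUnit_iff _).1 hu).1
    apply hv0
    apply hinj
    rw [LinearMap.mem_ker] at hv
    simp [hv]
  · have : c • (1 : E →ₗ[ℝ] E) + f.smulRight x = c • LinearMap.transvection (c⁻¹ • f) x := by
      ext v
      simp [LinearMap.transvection, smul_smul, hc]
    rw [this, LinearMap.det_smul, LinearMap.transvection.det]
    obtain ⟨k, hk⟩ : ∃ k, Module.finrank ℝ E = k + 1 := ⟨_, (Nat.sub_add_cancel (by omega)).symm⟩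
    rw [hk, Nat.add_sub_cancel, pow_succ]
    simp only [LinearMap.smul_apply, smul_eq_mul]
    field_simp

/-- Radial cutoff profile. -/
noncomputable def auxg (r : ℝ) : ℝ := Real.smoothTransition (r - 1) * Real.smoothTransition (4 - r)

theorem auxg_contDiff : ContDiff ℝ 1 auxg := by
  have h : ContDiff ℝ 1 Real.smoothTransition := Real.smoothTransition.contDiff (n := 1)
  exact (h.comp (contDiff_id.sub contDiff_const)).mul (h.comp (contDiff_const.sub contDiff_id))

theorem auxg_low {r : ℝ} (h : r ≤ 1) : auxg r = 0 := by
  simp [auxg, Real.smoothTransition.zero_of_nonpos (x := r - 1) (by linarith)]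

theorem auxg_high {r : ℝ} (h : 4 ≤ r) : auxg r = 0 := by
  simp [auxg, Real.smoothTransition.zero_of_nonpos (x := 4 - r) (by linarith)]

theorem auxg_left {r : ℝ} (h : r ≤ 3) : auxg r = Real.smoothTransition (r - 1) := by
  simp [auxg, Real.smoothTransition.one_of_one_le (x := 4 - r) (by linarith)]

theorem auxg_mid {r : ℝ} (h : 2 ≤ r) (h' : r ≤ 3) : auxg r = 1 := by
  rw [auxg_left h', Real.smoothTransition.one_of_one_le (by linarith)]

theorem auxg_deriv_nonneg {r : ℝ} (h : r < 3) : 0 ≤ deriv auxg r := by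
  have : auxg =ᶠ[nhds r] fun r => Real.smoothTransition (r - 1) := by
    filter_upwards [Iio_mem_nhds h] with y hy
    exact auxg_left (le_of_lt hy)
  rw [this.deriv_eq]
  apply Monotone.deriv_nonneg
  intro a b hab
  exact Real.smoothTransition.monotone (by linarith)

theorem auxg_deriv_pos : ∃ r, 1 < r ∧ r < 2 ∧ 0 < auxg r ∧ 0 < deriv auxg r := by
  obtain ⟨r, hr, hd⟩ := exists_deriv_eq_slope auxg (by norm_num : (1 : ℝ) < 2)
    auxg_contDiff.continuous.continuousOn
    (auxg_contDiff.differentiable (by norm_num)).differentiableOn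
  refine ⟨r, hr.1, hr.2, ?_, ?_⟩
  · rw [auxg_left (by linarith [hr.2])]
    exact Real.smoothTransition.pos_of_pos (by linarith [hr.1])
  · rw [hd, auxg_mid (by norm_num) (by norm_num), auxg_low le_rfl]; norm_num

section geom

variable {E : Type*} [NormedAddCommGroup E] [InnerProductSpace ℝ E] [FiniteDimensional ℝ E]

/-- Cut off the normalization of `L`. -/
noncomputable def auxF (L : E → E) (x : E) : E := auxg ‖x‖ • (‖L x‖⁻¹ • L x)

theorem auxF_contDiff (L : E → E) (hL : ∀ x, 1 / 2 < ‖x‖ → ContDiffAt ℝ 1 L x)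
    (hL0 : ∀ x, 1 / 2 < ‖x‖ → L x ≠ 0) : ContDiff ℝ 1 (auxF L) := by
  rw [contDiff_iff_contDiffAt]
  intro x
  by_cases hx : ‖x‖ < 1
  · have : auxF L =ᶠ[nhds x] fun _ => 0 := by
      filter_upwards [(isOpen_lt continuous_norm continuous_const).mem_nhds hx] with y hy
      simp only [auxF]
      rw [auxg_low (le_of_lt hy), zero_smul]
    exact contDiffAt_const.congr_of_eventuallyEq this
  · have h1 : 1 / 2 < ‖x‖ := by linarith
    have hx0 : x ≠ 0 := by rintro rfl; simp at h1; linarith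
    have hn : ContDiffAt ℝ 1 (fun y : E => auxg ‖y‖) x :=
      auxg_contDiff.contDiffAt.comp x (contDiffAt_norm ℝ hx0)
    have hl := hL x h1
    exact hn.smul (((hl.norm ℝ (hL0 x h1)).inv (norm_ne_zero_iff.2 (hL0 x h1))).smul hl)

theorem auxF_compact (L : E → E) : HasCompactSupport (auxF L) := by
  apply HasCompactSupport.intro (isCompact_closedBall (0 : E) 4)
  intro x hx
  simp only [Metric.mem_closedBall, dist_zero_right, not_le] at hx
  simp only [auxF]
  rw [auxg_high hx.le, zero_smul]

theorem aux_det_unit (F : E → E) (hF : Differentiable ℝ F) (x : E)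
    (h : ∀ᶠ y in nhds x, ‖F y‖ = 1) : (fderiv ℝ F x).det = 0 := by
  by_contra hdet
  have hu := (LinearMap.isUnit_iff_isUnit_det _).2 (isUnit_iff_ne_zero.2 hdet)
  obtain ⟨v, hv⟩ := ((Module.End.isUnit_iff _).1 hu).2 (F x)
  have h1 : HasFDerivAt (fun y => inner ℝ (F y) (F y)) _ x :=
    (hF x).hasFDerivAt.inner ℝ (hF x).hasFDerivAt
  have h2 : (fun y => inner ℝ (F y) (F y)) =ᶠ[nhds x] fun _ => (1 : ℝ) := by
    filter_upwards [h] with y hy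
    rw [real_inner_self_eq_norm_sq, hy]; norm_num
  have h3 := (h1.congr_of_eventuallyEq h2.symm).unique (hasFDerivAt_const (1 : ℝ) x)
  have h4 := congrArg (fun A => A v) h3
  have hv' : fderiv ℝ F x v = F x := hv
  simp [hv', h.self_of_nhds] at h4

theorem auxF_radial_det (h2 : 2 ≤ Module.finrank ℝ E) {x : E} (hx : x ≠ 0) :
    (fderiv ℝ (auxF (fun y : E => y)) x).det =
      (auxg ‖x‖ * ‖x‖⁻¹) ^ (Module.finrank ℝ E - 1) * deriv auxg ‖x‖ := by
  have hr : ‖x‖ ≠ 0 := norm_ne_zero_iff.2 hx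
  have hnd : DifferentiableAt ℝ (fun y : E => ‖y‖) x := (contDiffAt_norm ℝ hx).differentiableAt
    (n := 1) (by norm_num)
  have hg : HasDerivAt auxg (deriv auxg ‖x‖) ‖x‖ :=
    (auxg_contDiff.differentiable (by norm_num) _).hasDerivAt
  have hγ := hg.mul (hasDerivAt_inv hr)
  have hG := hγ.comp_hasFDerivAt x hnd.hasFDerivAt
  have hF := hG.smul (hasFDerivAt_id x)
  have hEq : auxF (fun y : E => y) =
      ((auxg * fun r => r⁻¹) ∘ fun y : E => ‖y‖) • (id : E → E) := by
    ext1 y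
    simp [auxF, smul_smul]
  have hfd : fderiv ℝ (auxF (fun y : E => y)) x = _ := (hEq ▸ hF).fderiv
  rw [hfd]
  set f : E →L[ℝ] ℝ := (deriv auxg ‖x‖ * ‖x‖⁻¹ + auxg ‖x‖ * -(‖x‖ ^ 2)⁻¹) •
    fderiv ℝ (fun y : E => ‖y‖) x with hf
  have := aux_det_rank_one h2 (auxg ‖x‖ * ‖x‖⁻¹) (f : E →ₗ[ℝ] ℝ) x
  have hfx : f x = (deriv auxg ‖x‖ * ‖x‖⁻¹ + auxg ‖x‖ * -(‖x‖ ^ 2)⁻¹) * ‖x‖ := by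
    simp [hf, hnd.fderiv_norm_self]
  calc _ = LinearMap.det ((auxg ‖x‖ * ‖x‖⁻¹) • (1 : E →ₗ[ℝ] E) + (f : E →ₗ[ℝ] ℝ).smulRight x) := by
        rfl
    _ = _ := by
        rw [this]
        congr 1
        rw [ContinuousLinearMap.coe_coe, hfx]
        field_simp
        ring

end geom

section main

open scoped Manifold ContDiff

variable {E : Type*} [NormedAddCommGroup E] [InnerProductSpace ℝ E] [FiniteDimensional ℝ E]

/-- Smoothing of the homotopy. -/
theorem aux_smoothing (F0 : E → E) (hF0 : ContinuousOn F0 {0}ᶜ)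
    (hlow : ∀ y : E, y ≠ 0 → ‖y‖ < 7 / 3 → F0 y = ‖y‖⁻¹ • y)
    (hhigh : ∀ y : E, 8 / 3 < ‖y‖ → F0 y = -(‖y‖⁻¹ • y))
    (hnorm : ∀ y : E, y ≠ 0 → ‖F0 y‖ = 1) :
    ∃ L : E → E, ContDiff ℝ 1 L ∧ (∀ y, 1 / 2 < ‖y‖ → L y ≠ 0) ∧
      (∀ y, 1 / 2 < ‖y‖ → ‖y‖ < 11 / 5 → L y = ‖y‖⁻¹ • y) ∧
      (∀ y, 14 / 5 < ‖y‖ → L y = -(‖y‖⁻¹ • y)) := by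
  have hN : ContDiffOn ℝ 1 (fun y : E => ‖y‖⁻¹ • y) {0}ᶜ := by
    intro y hy
    have hy0 : y ≠ 0 := hy
    exact (((contDiffAt_norm ℝ hy0).inv (norm_ne_zero_iff.2 hy0)).smul
      contDiffAt_id).contDiffWithinAt
  let t : E → Set E := fun y => {v | (1 / 2 < ‖y‖ → ‖v - F0 y‖ < 1 / 2) ∧
    (1 / 2 < ‖y‖ → ‖y‖ < 11 / 5 → v = ‖y‖⁻¹ • y) ∧ (14 / 5 < ‖y‖ → v = -(‖y‖⁻¹ • y))}
  have ht : ∀ y, Convex ℝ (t y) := by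
    intro y
    have c1 : Convex ℝ {v : E | 1 / 2 < ‖y‖ → ‖v - F0 y‖ < 1 / 2} := by
      by_cases h : 1 / 2 < ‖y‖
      · simp only [h, forall_true_left]
        have := convex_ball (F0 y) (1 / 2)
        simpa [Metric.ball, dist_eq_norm] using this
      · simp only [h, false_imp_iff]; exact convex_univ
    have c2 : Convex ℝ {v : E | 1 / 2 < ‖y‖ → ‖y‖ < 11 / 5 → v = ‖y‖⁻¹ • y} := by
      by_cases h : 1 / 2 < ‖y‖
      · by_cases h' : ‖y‖ < 11 / 5
        · simp only [h, h', forall_true_left]; exact convex_singleton _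
        · simp only [h', false_imp_iff, implies_true]; exact convex_univ
      · simp only [h, false_imp_iff]; exact convex_univ
    have c3 : Convex ℝ {v : E | 14 / 5 < ‖y‖ → v = -(‖y‖⁻¹ • y)} := by
      by_cases h : 14 / 5 < ‖y‖
      · simp only [h, forall_true_left]; exact convex_singleton _
      · simp only [h, false_imp_iff]; exact convex_univ
    exact c1.inter (c2.inter c3)
  have hgt : ∀ a : ℝ, ∀ x : E, a < ‖x‖ → {y : E | a < ‖y‖} ∈ nhds x := fun a x h =>
    (isOpen_lt continuous_const continuous_norm).mem_nhds h
  have hlt : ∀ a : ℝ, ∀ x : E, ‖x‖ < a → {y : E | ‖y‖ < a} ∈ nhds x := fun a x h =>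
    (isOpen_lt continuous_norm continuous_const).mem_nhds h
  have hne : ∀ y : E, 0 < ‖y‖ → y ≠ 0 := fun y h => norm_pos_iff.1 h
  have hloc : ∀ x : E, ∃ U ∈ nhds x, ∃ g : E → E,
      ContMDiffOn 𝓘(ℝ, E) 𝓘(ℝ, E) 1 g U ∧ ∀ y ∈ U, g y ∈ t y := by
    intro x
    rcases lt_or_ge ‖x‖ (1 / 2) with h1 | h1
    · refine ⟨_, hlt _ x h1, fun _ => 0, contMDiffOn_const, ?_⟩
      intro y (hy : ‖y‖ < 1 / 2)
      exact ⟨fun h => by linarith, fun h => by linarith, fun h => by linarith⟩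
    rcases lt_or_ge ‖x‖ (7 / 3) with h2 | h2
    · refine ⟨_, Filter.inter_mem (hgt 0 x (by linarith)) (hlt _ x h2), fun y => ‖y‖⁻¹ • y,
        (hN.mono ?_).contMDiffOn, ?_⟩
      · rintro y ⟨hy, -⟩
        exact hne y hy
      · rintro y ⟨hy, hy' : ‖y‖ < 7 / 3⟩
        refine ⟨fun _ => ?_, fun _ _ => rfl, fun h => by linarith⟩
        rw [hlow y (hne y hy) hy']; simp
    rcases le_or_gt ‖x‖ (8 / 3) with h3 | h3
    · have hx0 : x ≠ 0 := hne x (by linarith)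
      have hc : ContinuousAt F0 x := hF0.continuousAt (isOpen_compl_singleton.mem_nhds hx0)
      have hc' : {y | dist (F0 y) (F0 x) < 1 / 2} ∈ nhds x :=
        hc (Metric.ball_mem_nhds _ (by norm_num))
      refine ⟨_, Filter.inter_mem hc' (Filter.inter_mem (hgt (11 / 5) x (by linarith))
        (hlt (14 / 5) x (by linarith))), fun _ => F0 x, contMDiffOn_const, ?_⟩
      rintro y ⟨hy, hy1 : 11 / 5 < ‖y‖, hy2 : ‖y‖ < 14 / 5⟩
      refine ⟨fun _ => ?_, fun _ h => by linarith, fun h => by linarith⟩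
      rw [← dist_eq_norm, dist_comm]; exact hy
    · refine ⟨_, hgt _ x h3, fun y => -(‖y‖⁻¹ • y), (hN.neg.mono ?_).contMDiffOn, ?_⟩
      · intro y (hy : 8 / 3 < ‖y‖)
        exact hne y (by linarith)
      · intro y (hy : 8 / 3 < ‖y‖)
        refine ⟨fun _ => ?_, fun _ h => by linarith, fun _ => rfl⟩
        rw [hhigh y hy]; simp
  obtain ⟨L, hL⟩ := exists_contMDiffMap_forall_mem_convex_of_local (n := 1) 𝓘(ℝ, E) ht hloc
  refine ⟨L, L.contMDiff.contDiff, ?_, fun y => (hL y).2.1, fun y => (hL y).2.2⟩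
  intro y hy h0
  have h1 := (hL y).1 hy
  rw [h0, zero_sub, norm_neg, hnorm y (hne y (by linarith))] at h1
  norm_num at h1

theorem aux_no_smooth (hodd : Odd (Module.finrank ℝ E)) (h2 : 2 ≤ Module.finrank ℝ E)
    (L : E → E) (hL : ContDiff ℝ 1 L) (hL0 : ∀ y, 1 / 2 < ‖y‖ → L y ≠ 0)
    (hlow : ∀ y, 1 / 2 < ‖y‖ → ‖y‖ < 11 / 5 → L y = ‖y‖⁻¹ • y)
    (hhigh : ∀ y, 14 / 5 < ‖y‖ → L y = -(‖y‖⁻¹ • y)) : False := by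
  borelize E
  have : Nontrivial E := Module.nontrivial_of_finrank_pos (R := ℝ) (by omega)
  set F := auxF L with hF
  set P : E → E := auxF (fun y : E => y) with hP
  have hne : ∀ y : E, 0 < ‖y‖ → y ≠ 0 := fun y h => norm_pos_iff.1 h
  have cF : ContDiff ℝ 1 F := auxF_contDiff L (fun x _ => hL.contDiffAt) hL0
  have cP : ContDiff ℝ 1 P := auxF_contDiff _ (fun x _ => contDiffAt_id)
    (fun x h => hne x (by linarith))
  have iF : ∫ x, (fderiv ℝ F x).det = 0 := aux_integral_det F cF (auxF_compact L)
  have iP : ∫ x, (fderiv ℝ P x).det = 0 := aux_integral_det P cP (auxF_compact _)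
  have det0 : (0 : E →L[ℝ] E).det = 0 := LinearMap.det_zero''
  have cont : ∀ Q : E → E, ContDiff ℝ 1 Q → Continuous (fun x => (fderiv ℝ Q x).det) :=
    fun Q hQ => ContinuousLinearMap.continuous_det.comp (hQ.continuous_fderiv (by norm_num))
  have comp : ∀ Q : E → E, HasCompactSupport Q →
      HasCompactSupport (fun x => (fderiv ℝ Q x).det) :=
    fun Q hQ => (hQ.fderiv (𝕜 := ℝ)).comp_left (g := fun A : E →L[ℝ] E => A.det) det0
  have uP : ∀ x : E, x ≠ 0 → P x = auxg ‖x‖ • (‖x‖⁻¹ • x) := fun x _ => rfl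
  have hnn : ∀ y : E, y ≠ 0 → ‖‖y‖⁻¹ • y‖ = 1 := fun y hy => by
    rw [norm_smul, norm_inv, norm_norm, inv_mul_cancel₀ (norm_ne_zero_iff.2 hy)]
  -- determinant of P
  have dP : ∀ x : E, ‖x‖ < 3 → 0 ≤ (fderiv ℝ P x).det := by
    intro x hx
    by_cases hx0 : x = 0
    · have : P =ᶠ[nhds x] fun _ => 0 := by
        filter_upwards [(isOpen_lt continuous_norm continuous_const).mem_nhds
          (show ‖x‖ < 1 by simp [hx0])] with y hy
        simp only [hP, auxF]
        rw [auxg_low (le_of_lt hy), zero_smul]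
      rw [this.fderiv_eq]
      simp [det0]
    · rw [hP, auxF_radial_det h2 hx0]
      have hev : Even (Module.finrank ℝ E - 1) := Nat.Odd.sub_odd hodd odd_one
      exact mul_nonneg (hev.pow_nonneg _) (auxg_deriv_nonneg hx)
  have dmid : ∀ Q : E → E, (∀ y, 1 / 2 < ‖y‖ → Q y ≠ 0) → ContDiff ℝ 1 (auxF Q) → ∀ x : E,
      2 < ‖x‖ → ‖x‖ < 3 → (fderiv ℝ (auxF Q) x).det = 0 := by
    intro Q hQ0 hQ x h h'
    apply aux_det_unit _ (hQ.differentiable (by norm_num))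
    filter_upwards [(isOpen_lt continuous_norm continuous_const).mem_nhds h',
      (isOpen_lt continuous_const continuous_norm).mem_nhds h] with y hy hy'
    rw [auxF, auxg_mid hy'.le hy.le, one_smul]
    exact hnn _ (hQ0 y (by linarith))
  set k : E → ℝ := fun x => (fderiv ℝ F x).det + (fderiv ℝ P x).det with hk
  have hsame : ∀ x : E, ‖x‖ < 11 / 5 → fderiv ℝ F x = fderiv ℝ P x := by
    intro x hx
    apply Filter.EventuallyEq.fderiv_eq
    filter_upwards [(isOpen_lt continuous_norm continuous_const).mem_nhds hx] with y hy
    rcases le_or_gt ‖y‖ (1 / 2) with h | h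
    · simp only [hF, hP, auxF]
      rw [auxg_low (by linarith), zero_smul, zero_smul]
    · simp only [hF, hP, auxF]
      rw [hlow y h hy, hnn y (hne y (by linarith)), inv_one, one_smul]
  have hk0 : 0 ≤ k := by
    intro x
    simp only [hk, Pi.zero_apply]
    rcases lt_or_ge ‖x‖ (11 / 5) with h | h
    · rw [hsame x h]
      have := dP x (by linarith)
      linarith
    rcases lt_or_ge ‖x‖ 3 with h' | h'
    · rw [hF, hP, dmid L hL0 cF x (by linarith) h',
        dmid _ (fun y h => hne y (by linarith)) cP x (by linarith) h']
      norm_num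
    · have : F =ᶠ[nhds x] fun y => -P y := by
        filter_upwards [(isOpen_lt continuous_const continuous_norm).mem_nhds
          (show 14 / 5 < ‖x‖ by linarith)] with y hy
        simp only [hF, hP, auxF]
        rw [hhigh y hy, norm_neg, hnn y (hne y (by linarith)), inv_one, one_smul, smul_neg]
      rw [this.fderiv_eq, fderiv_fun_neg]
      have hneg : (-(fderiv ℝ P x)).det = -(fderiv ℝ P x).det := by
        have := LinearMap.det_smul (-1 : ℝ) ((fderiv ℝ P x : E →L[ℝ] E) : E →ₗ[ℝ] E)
        rw [hodd.neg_one_pow, neg_one_mul, neg_one_smul] at this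
        exact this
      rw [hneg]; linarith
  obtain ⟨r, hr1, hr2, hg, hd⟩ := auxg_deriv_pos
  obtain ⟨x, hx⟩ := exists_norm_eq E (c := r) (by linarith)
  have hx0 : x ≠ 0 := hne x (by linarith)
  have hkx : k x ≠ 0 := by
    simp only [hk]
    rw [hsame x (by linarith), hP, auxF_radial_det h2 hx0, hx]
    have : 0 < r := by linarith
    positivity
  have ck := (cont F cF).add (cont P cP)
  have sk : HasCompactSupport k := (comp F (auxF_compact L)).add (comp P (auxF_compact _))
  have := Continuous.integral_pos_of_hasCompactSupport_nonneg_nonzero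
    (μ := MeasureTheory.volume) ck sk hk0 hkx
  rw [MeasureTheory.integral_add'
    ((cont F cF).integrable_of_hasCompactSupport (comp F (auxF_compact L)))
    ((cont P cP).integrable_of_hasCompactSupport (comp P (auxF_compact _))), iF, iP] at this
  norm_num at this

theorem aux_no_homotopy (hodd : Odd (Module.finrank ℝ E)) (h2 : 2 ≤ Module.finrank ℝ E)
    (a : C(Metric.sphere (0 : E) 1, Metric.sphere (0 : E) 1)) (ha : ∀ x, (a x : E) = -x)
    (h : ContinuousMap.Homotopic (ContinuousMap.id _) a) : False := by
  classical
  obtain ⟨H⟩ := h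
  let σ : ({0}ᶜ : Set E) → Metric.sphere (0 : E) 1 := fun y =>
    ⟨‖(y : E)‖⁻¹ • (y : E), by
      rw [mem_sphere_zero_iff_norm, norm_smul, norm_inv, norm_norm,
        inv_mul_cancel₀ (norm_ne_zero_iff.2 y.2)]⟩
  have hσ : Continuous σ := by
    apply Continuous.subtype_mk
    exact (continuous_subtype_val.norm.inv₀ (fun y => norm_ne_zero_iff.2 y.2)).smul
      continuous_subtype_val
  let θ : E → unitInterval := fun y => Set.projIcc 0 1 zero_le_one (3 * (‖y‖ - 2) - 1)
  have hθ : Continuous θ := continuous_projIcc.comp (by fun_prop)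
  let F0 : E → E := fun y => if hy : y ∈ ({0}ᶜ : Set E) then (H (θ y, σ ⟨y, hy⟩) : E) else 0
  have hF0 : ∀ y : E, ∀ hy : y ∈ ({0}ᶜ : Set E), F0 y = (H (θ y, σ ⟨y, hy⟩) : E) :=
    fun y hy => by simp only [F0]; rw [dif_pos hy]
  obtain ⟨L, h1, h2', h3, h4⟩ := aux_smoothing F0 (by
      rw [continuousOn_iff_continuous_domRestrict]
      have : (({0}ᶜ : Set E).domRestrict F0) = fun y : ({0}ᶜ : Set E) => (H (θ (y : E), σ y) : E) := by
        ext1 y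
        exact hF0 y y.2
      rw [this]
      exact continuous_subtype_val.comp (H.continuous.comp
        ((hθ.comp continuous_subtype_val).prodMk hσ)))
    (fun y hy hlt => by
      rw [hF0 y hy]
      have : θ y = 0 := Set.projIcc_of_le_left _ (by linarith)
      rw [this, H.apply_zero]; rfl)
    (fun y hgt => by
      have hy : y ∈ ({0}ᶜ : Set E) := norm_pos_iff.1 (by linarith)
      rw [hF0 y hy]
      have : θ y = 1 := Set.projIcc_of_right_le _ (by linarith)
      rw [this, H.apply_one, ha])
    (fun y hy => by
      rw [hF0 y hy]
      exact mem_sphere_zero_iff_norm.1 (H _).2)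
  exact aux_no_smooth hodd h2 L h1 h2' h3 h4

/-- A fixed point free self-map of a sphere is homotopic to the antipodal map. -/
theorem aux_antipodal (a f : C(Metric.sphere (0 : E) 1, Metric.sphere (0 : E) 1))
    (ha : ∀ x, (a x : E) = -x) (hf : ∀ x, f x ≠ x) : ContinuousMap.Homotopic f a := by
  let K : unitInterval × Metric.sphere (0 : E) 1 → E := fun p =>
    (1 - (p.1 : ℝ)) • (f p.2 : E) - (p.1 : ℝ) • (p.2 : E)
  have hKc : Continuous K := by fun_prop
  have hn : ∀ x : Metric.sphere (0 : E) 1, ‖(x : E)‖ = 1 := fun x => mem_sphere_zero_iff_norm.1 x.2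
  have hK0 : ∀ p, K p ≠ 0 := by
    rintro ⟨t, x⟩ h
    have h1 : (1 - (t : ℝ)) • (f x : E) = (t : ℝ) • (x : E) := sub_eq_zero.1 h
    have h2 := congrArg norm h1
    rw [norm_smul, norm_smul, hn, hn, mul_one, mul_one, Real.norm_eq_abs, Real.norm_eq_abs,
      abs_of_nonneg (by linarith [t.2.2]), abs_of_nonneg t.2.1] at h2
    rw [h2] at h1
    have h3 : (t : ℝ) ≠ 0 := by intro h; rw [h] at h2; norm_num at h2
    exact hf x (Subtype.ext (smul_right_injective E h3 h1))
  refine ⟨⟨⟨fun p => ⟨‖K p‖⁻¹ • K p, ?_⟩, ?_⟩, ?_, ?_⟩⟩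
  · rw [mem_sphere_zero_iff_norm, norm_smul, norm_inv, norm_norm,
      inv_mul_cancel₀ (norm_ne_zero_iff.2 (hK0 p))]
  · exact ((hKc.norm.inv₀ (fun p => norm_ne_zero_iff.2 (hK0 p))).smul hKc).subtype_mk _
  · intro x
    apply Subtype.ext
    simp [K, hn]
  · intro x
    apply Subtype.ext
    simp [K, hn, ha]

end main

/-- If a finite group `G` acts freely on an even-dimensional sphere
`S^n` (`n` even, `n ≥ 2`) by homeomorphisms (equivalently, by a continuous
action, since `G` is finite), then `G` is trivial or cyclic of order 2. -/
theorem finite_group_free_action_even_sphere (n : ℕ) (hn : Even n) (h2 : 2 ≤ n)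
    (G : Type*) [Group G] [Finite G] [MulAction G (Sph n)]
    (hcont : ∀ g : G, Continuous fun x : Sph n => g • x)
    (hfree : ∀ g : G, g ≠ 1 → ∀ x : Sph n, g • x ≠ x) :
    Nat.card G = 1 ∨ (IsCyclic G ∧ Nat.card G = 2) := by
  let a : C(Sph n, Sph n) := ⟨fun x => -x, continuous_neg⟩
  have ha : ∀ x, (a x : EuclideanSpace ℝ (Fin (n + 1))) = -x := fun x => rfl
  let φ : G → C(Sph n, Sph n) := fun g => ⟨fun x => g • x, hcont g⟩
  have hφ : ∀ g : G, g ≠ 1 → ContinuousMap.Homotopic (φ g) a := fun g hg =>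
    aux_antipodal a (φ g) ha (hfree g hg)
  have key : ∀ g h : G, g ≠ 1 → h ≠ 1 → g * h = 1 := by
    intro g h hg hh
    by_contra hgh
    have e1 : φ (g * h) = (φ g).comp (φ h) := by
      ext1 x
      exact mul_smul g h x
    have e2 : a.comp a = ContinuousMap.id _ := by
      ext1 x
      exact neg_neg x
    have h1 : ContinuousMap.Homotopic (φ (g * h)) (ContinuousMap.id _) := by
      rw [e1, ← e2]
      exact ContinuousMap.Homotopic.comp (hφ g hg) (hφ h hh)
    refine aux_no_homotopy (E := EuclideanSpace ℝ (Fin (n + 1))) ?_ ?_ a ha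
      (h1.symm.trans (hφ _ hgh))
    · rw [finrank_euclideanSpace_fin]; exact hn.add_one
    · rw [finrank_euclideanSpace_fin]; omega
  rcases subsingleton_or_nontrivial G with hs | hs
  · left; exact Nat.card_of_subsingleton 1
  · right
    obtain ⟨g, hg⟩ := exists_ne (1 : G)
    have hcard : Nat.card G = 2 := by
      rw [Nat.card_eq_two_iff]
      refine ⟨1, g, hg.symm, ?_⟩
      rw [Set.eq_univ_iff_forall]
      intro h
      by_cases hh : h = 1
      · left; exact hh
      · right
        exact mul_left_cancel ((key g h hg hh).trans (key g g hg hg).symm)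
    have : Fact (Nat.Prime 2) := ⟨Nat.prime_two⟩
    exact ⟨isCyclic_of_prime_card hcard, hcard⟩
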